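/- Let T_1, T_2 be self-adjoint operators in separable complex Hilbert spaces H_1, H_2 respectively, with T_j^{-1} ∈ B(H_j), and let S be a closed operator from dom(S) ⊆ H_1 to H_2 with dom(S) ⊇ dom(T_1) and dom(S*) ⊇ dom(T_2). Then T_2^{-z}ST_1^{-1+z}, defined on dom(T_1), is closable for every z ∈ Σ̄ = {z : Re z ∈ [0,1]}, its closure lies in B(H_1,H_2), and for every k ∈ (0,∞): ||cl(T_2^{-z}ST_1^{-1+z})||_{B(H_1,H_2)} ≤ C(z,k) · ||ST_1^{-1}||_{B(H_1,H_2)}^{1−Re z} · ||S*T_2^{-1}||_{B(H_2,H_1)}^{Re z}, where C(z,k) = e^{k|Im z|² + k Re z(1−Re z) + k^{-1}π²} in general, C(z,k) = e^{k|Im z|² + k Re z(1−Re z) + (4k)^{-1}π²} if T_1 ≥ 0 or T_2 ≥ 0, and C(z,k) = 1 if both T_1 ≥ 0 and T_2 ≥ 0. In particular, for x ∈ [0,1], ||cl(T_2^{-x}ST_1^{-1+x})||_{B(H_1,H_2)} ≤ c(x) · ||ST_1^{-1}||^{1−x} · ||S*T_2^{-1}||^{x} with c(x) = e^{2π[x(1−x)]^{1/2}}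 in general, c(x) = e^{π[x(1−x)]^{1/2}} if T_1 ≥ 0 or T_2 ≥ 0, and c(x) = 1 if both T_j ≥ 0. -/

import Mathlib

noncomputable section

open scoped ENNReal InnerProductSpace

namespace OpInterp

section Mcomp

variable {R E F G : Type*} [CommRing R] [AddCommGroup E] [Module R E]
  [AddCommGroup F] [Module R F] [AddCommGroup G] [Module R G]

/-- The maximal domain of the composition `g ∘ f` of two partial linear maps. -/
def mcompDomain (g : F →ₗ.[R] G) (f : E →ₗ.[R] F) : Submodule R E where
  carrier := {x | ∃ hx : x ∈ f.domain, f ⟨x, hx⟩ ∈ g.domain}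
  zero_mem' := ⟨f.domain.zero_mem, by
    have h0 : (⟨(0 : E), f.domain.zero_mem⟩ : f.domain) = 0 := rfl
    rw [h0, f.map_zero]; exact g.domain.zero_mem⟩
  add_mem' := by
    rintro x y ⟨hx, hfx⟩ ⟨hy, hfy⟩
    refine ⟨f.domain.add_mem hx hy, ?_⟩
    have h : (⟨x + y, f.domain.add_mem hx hy⟩ : f.domain) = ⟨x, hx⟩ + ⟨y, hy⟩ := rfl
    rw [h, f.map_add]
    exact g.domain.add_mem hfx hfy
  smul_mem' := by
    rintro c x ⟨hx, hfx⟩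
    refine ⟨f.domain.smul_mem c hx, ?_⟩
    have h : (⟨c • x, f.domain.smul_mem c hx⟩ : f.domain) = c • (⟨x, hx⟩ : f.domain) := rfl
    rw [h, f.map_smul]
    exact g.domain.smul_mem c hfx

theorem mem_mcompDomain {g : F →ₗ.[R] G} {f : E →ₗ.[R] F} {x : E} :
    x ∈ mcompDomain g f ↔ ∃ hx : x ∈ f.domain, f ⟨x, hx⟩ ∈ g.domain := Iff.rfl

/-- The inclusion of the maximal composition domain into the domain of `f`. -/
def mcompIncl (g : F →ₗ.[R] G) (f : E →ₗ.[R] F) : mcompDomain g f →ₗ[R] f.domain where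
  toFun x := ⟨(x : E), x.2.choose⟩
  map_add' x y := Subtype.ext rfl
  map_smul' c x := Subtype.ext rfl

theorem mcompIncl_mem (g : F →ₗ.[R] G) (f : E →ₗ.[R] F) (x : mcompDomain g f) :
    f (mcompIncl g f x) ∈ g.domain := by
  exact x.2.choose_spec

/-- The maximally defined composition of two partial linear maps: its domain consists of
all `x ∈ dom f` with `f x ∈ dom g`. -/
def mcomp (g : F →ₗ.[R] G) (f : E →ₗ.[R] F) : E →ₗ.[R] G where
  domain := mcompDomain g f
  toFun := g.toFun.comp ((f.toFun.comp (mcompIncl g f)).codRestrict g.domain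
    fun x => mcompIncl_mem g f x)

theorem mcomp_domain (g : F →ₗ.[R] G) (f : E →ₗ.[R] F) :
    (mcomp g f).domain = mcompDomain g f := rfl

end Mcomp

section Hilbert

variable {E F G : Type*} [NormedAddCommGroup E] [InnerProductSpace ℂ E]
  [NormedAddCommGroup F] [InnerProductSpace ℂ F]
  [NormedAddCommGroup G] [InnerProductSpace ℂ G]

/-- `B ∈ B(F,E)` is the (everywhere defined, bounded) inverse of the partial linear
map `T`; this encodes the hypothesis `T⁻¹ ∈ B(H)`. -/
def IsBoundedInverse (T : E →ₗ.[ℂ] F) (B : F →L[ℂ] E) : Prop :=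
  (∀ x : T.domain, B (T x) = x) ∧ ∀ y : F, ∃ hy : B y ∈ T.domain, T ⟨B y, hy⟩ = y

/-- `C = S ∘ B` holds, where the bounded operator `B` maps into the domain of `S`;
this encodes hypotheses such as `S T⁻¹ ∈ B(H)` with `B = T⁻¹` and `C = S T⁻¹`. -/
def IsComposition (S : E →ₗ.[ℂ] F) (B : G →L[ℂ] E) (C : G →L[ℂ] F) : Prop :=
  ∀ y : G, ∃ hy : B y ∈ S.domain, S ⟨B y, hy⟩ = C y

/-- The bounded operator `B` extends the partial linear map `Y`.  If `Y` is densely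
defined this says precisely that `Y` is closable with bounded closure `B` (on all of `H`). -/
def ExtendsTo (Y : E →ₗ.[ℂ] F) (B : E →L[ℂ] F) : Prop :=
  ∀ x : Y.domain, Y x = B x

/-- The partial linear map `Y` is bounded on its domain. -/
def IsBddPMap (Y : E →ₗ.[ℂ] F) : Prop :=
  ∃ c : ℝ, ∀ x : Y.domain, ‖Y x‖ ≤ c * ‖(x : E)‖

/-- `Y ∈ B(H)`: the partial linear map `Y` is everywhere defined and given by the
bounded operator `B`. -/
def IsBoundedOp (Y : E →ₗ.[ℂ] F) (B : E →L[ℂ] F) : Prop :=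
  Y.domain = ⊤ ∧ ExtendsTo Y B

/-- Nonnegativity (`T ≥ 0`) of a partial linear map on a complex Hilbert space. -/
def IsNonnegPMap (T : E →ₗ.[ℂ] E) : Prop :=
  ∀ x : T.domain, 0 ≤ (⟪(x : E), T x⟫_ℂ).re ∧ (⟪(x : E), T x⟫_ℂ).im = 0

/-- The `n`-th approximation number of a bounded operator; for operators between Hilbert
spaces these are exactly the singular values `s_{n+1}(A)`. -/
def approxNumber (A : E →L[ℂ] F) (n : ℕ) : ℝ :=
  sInf {c : ℝ | ∃ B : E →L[ℂ] F, Module.finrank ℂ (LinearMap.range (B : E →ₗ[ℂ] F)) ≤ n ∧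
    ‖A - B‖ = c}

/-- The Schatten–von Neumann `p`-norm `‖A‖_{B_p}` (`= (∑ s_n(A)^p)^{1/p}`), valued in
`[0,∞]`; for `p = ∞` it is the operator norm. -/
def schattenNorm (p : ℝ≥0∞) (A : E →L[ℂ] F) : ℝ≥0∞ :=
  if p = ∞ then (‖A‖₊ : ℝ≥0∞)
  else (∑' n : ℕ, ENNReal.ofReal (approxNumber A n) ^ p.toReal) ^ (1 / p.toReal)

/-- Membership in the Schatten–von Neumann ideal `B_p`. -/
def MemSchatten (p : ℝ≥0∞) (A : E →L[ℂ] F) : Prop :=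
  schattenNorm p A ≠ ∞

end Hilbert

/-- The open strip `Σ = {z : 0 < Re z < 1}`. -/
def strip : Set ℂ := {z : ℂ | z.re ∈ Set.Ioo (0 : ℝ) 1}

/-- The closed strip `Σ̄ = {z : 0 ≤ Re z ≤ 1}`. -/
def closedStrip : Set ℂ := {z : ℂ | z.re ∈ Set.Icc (0 : ℝ) 1}

end OpInterp
section Structures

variable {E F : Type*} [NormedAddCommGroup E] [InnerProductSpace ℂ E] [CompleteSpace E]
  [NormedAddCommGroup F] [InnerProductSpace ℂ F] [CompleteSpace F]

namespace OpInterp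

/-- `Q` is the family of real powers `α ↦ R^α` of the nonnegative self-adjoint operator `R`,
as provided by the spectral theorem (these properties characterize it uniquely). -/
structure IsRealPowerFamily (R : E →ₗ.[ℂ] E) (Q : ℝ → E →ₗ.[ℂ] E) : Prop where
  zero : Q 0 = (LinearMap.id : E →ₗ[ℂ] E).toPMap ⊤
  one : Q 1 = R
  selfAdjoint : ∀ a : ℝ, 0 ≤ a → IsSelfAdjoint (Q a)
  nonneg : ∀ a : ℝ, 0 ≤ a → IsNonnegPMap (Q a)
  semigroup : ∀ a b : ℝ, 0 ≤ a → 0 ≤ b → mcomp (Q a) (Q b) = Q (a + b)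
  domain_antitone : ∀ a b : ℝ, 0 ≤ a → a ≤ b → (Q b).domain ≤ (Q a).domain

/-- `P` is the family `z ↦ T^{-z}` (`Re z ≥ 0`) of complex powers of the boundedly
invertible self-adjoint operator `T`, defined by the spectral theorem of `T` via the branch
`λ^z = λ^{Re z} e^{i Im z ln|λ|}[θ(λ) + e^{-π Im z}θ(-λ)]`. -/
structure IsSpectralInvPowers (T : E →ₗ.[ℂ] E) (Tinv : E →L[ℂ] E)
    (P : ℂ → E →L[ℂ] E) : Prop where
  zero : P 0 = 1
  one : P 1 = Tinv
  semigroup : ∀ z w : ℂ, 0 ≤ z.re → 0 ≤ w.re → P (z + w) = P z ∘L P w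
  /-- `‖T^{iy}‖ ≤ max (1, e^{-π y})`, i.e. `‖P (i s)‖ = ‖T^{-i s}‖ ≤ max (1, e^{π s})`. -/
  norm_imaginary : ∀ s : ℝ, ‖P (Complex.I * s)‖ ≤ max 1 (Real.exp (Real.pi * s))
  norm_le : ∀ z : ℂ, z.re ∈ Set.Icc (0 : ℝ) 1 →
    ‖P z‖ ≤ max 1 ‖Tinv‖ * max 1 (Real.exp (Real.pi * |z.im|))
  /-- if `T ≥ 0` then the imaginary powers are unitary. -/
  isometry_imaginary_of_nonneg : IsNonnegPMap T → ∀ (s : ℝ) (x : E),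
    ‖P (Complex.I * s) x‖ = ‖x‖
  strong_continuous : ∀ x : E, ContinuousOn (fun z => P z x) {z : ℂ | 0 ≤ z.re}
  analytic : ∀ x : E, DifferentiableOn ℂ (fun z => P z x) {z : ℂ | 0 < z.re}
  mapsTo_domain : ∀ z : ℂ, 0 ≤ z.re → ∀ x : E, x ∈ T.domain → P z x ∈ T.domain
  commutes : ∀ z : ℂ, 0 ≤ z.re → ∀ x : T.domain,
    ∀ hx : P z (x : E) ∈ T.domain, T ⟨P z (x : E), hx⟩ = P z (T x)

/-- `R = |S| = (S^*S)^{1/2}`, the modulus of the densely defined closed operator `S`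
(these properties characterize `|S|` uniquely). -/
structure IsModulus (S : E →ₗ.[ℂ] F) (R : E →ₗ.[ℂ] E) : Prop where
  selfAdjoint : IsSelfAdjoint R
  nonneg : IsNonnegPMap R
  domain_eq : R.domain = S.domain
  norm_eq : ∀ (x : R.domain) (hx : (x : E) ∈ S.domain), ‖R x‖ = ‖S ⟨(x : E), hx⟩‖

/-- `U = U_S`, the partial isometry in the polar decomposition `S = U_S |S|`
(with `R = |S|` and initial space `cl (ran |S|)`). -/
structure IsPolarPartialIsometry (S : E →ₗ.[ℂ] F) (R : E →ₗ.[ℂ] E) (U : E →L[ℂ] F) :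
    Prop where
  map_eq : ∀ (x : S.domain) (hx : (x : E) ∈ R.domain), U (R ⟨(x : E), hx⟩) = S x
  norm_map : ∀ x : R.domain, ‖U (R x)‖ = ‖R x‖
  ker_perp : ∀ y : E, (∀ x : R.domain, ⟪R x, y⟫_ℂ = 0) → U y = 0

/-- The open sector `S_ω` with vertex `0`, opening half-angle `ω`, along the positive
real axis; `S_0 = (0,∞)`. -/
def sector (ω : ℝ) : Set ℂ :=
  if ω = 0 then {z : ℂ | z ≠ 0 ∧ Complex.arg z = 0}
  else {z : ℂ | z ≠ 0 ∧ |Complex.arg z| < ω}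

/-- `R = (T - ζ)⁻¹ ∈ B(H)`, i.e. `ζ` belongs to the resolvent set of `T` with
resolvent `R`. -/
def IsResolventAt (T : E →ₗ.[ℂ] E) (ζ : ℂ) (R : E →L[ℂ] E) : Prop :=
  (∀ x : T.domain, R (T x - ζ • (x : E)) = x) ∧
    ∀ y : E, ∃ hy : R y ∈ T.domain, T ⟨R y, hy⟩ - ζ • R y = y

/-- The resolvent set of the partial linear map `T`. -/
def presolventSet (T : E →ₗ.[ℂ] E) : Set ℂ :=
  {ζ : ℂ | ∃ R : E →L[ℂ] E, IsResolventAt T ζ R}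

/-- The spectrum of the partial linear map `T`. -/
def pspectrum (T : E →ₗ.[ℂ] E) : Set ℂ := (presolventSet T)ᶜ

/-- `T` is a (densely defined, closed) sectorial operator of angle `ω ∈ [0,π)`. -/
structure IsSectorial (T : E →ₗ.[ℂ] E) (ω : ℝ) : Prop where
  denseDomain : Dense (T.domain : Set E)
  isClosed : T.IsClosed
  angle_mem : ω ∈ Set.Ico (0 : ℝ) Real.pi
  spectrum_subset : pspectrum T ⊆ closure (sector ω)
  resolvent_bound : ∀ ω' ∈ Set.Ioo ω Real.pi, ∃ M : ℝ,
    ∀ ζ ∉ closure (sector ω'), ∀ R : E →L[ℂ] E, IsResolventAt T ζ R → ‖ζ • R‖ ≤ M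

/-- `P` is the family `z ↦ T^{-z}` (`Re z ≥ 0`) of fractional powers of the sectorial
operator `T` (defined via the Dunford integral for `Re z > 0` and by strong limits on the
boundary), with bounded imaginary powers: `T ∈ BIP(N,θ)`,
`‖T^{is}‖ = ‖P (-is)‖ ≤ N e^{θ|s|}`. -/
structure IsBIPInvPowers (T : E →ₗ.[ℂ] E) (Tinv : E →L[ℂ] E) (N θ : ℝ)
    (P : ℂ → E →L[ℂ] E) : Prop where
  zero : P 0 = 1
  one : P 1 = Tinv
  semigroup : ∀ z w : ℂ, 0 ≤ z.re → 0 ≤ w.re → P (z + w) = P z ∘L P w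
  bip : ∀ s : ℝ, ‖P (Complex.I * s)‖ ≤ N * Real.exp (θ * |s|)
  strong_continuous : ∀ x : E, ContinuousOn (fun z => P z x) {z : ℂ | 0 ≤ z.re}
  analytic : ∀ x : E, DifferentiableOn ℂ (fun z => P z x) {z : ℂ | 0 < z.re}
  mapsTo_domain : ∀ z : ℂ, 0 ≤ z.re → ∀ x : E, x ∈ T.domain → P z x ∈ T.domain
  commutes : ∀ z : ℂ, 0 ≤ z.re → ∀ x : T.domain,
    ∀ hx : P z (x : E) ∈ T.domain, T ⟨P z (x : E), hx⟩ = P z (T x)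

end OpInterp

end Structures

namespace OpInterp

open Filter Topology Complex.HadamardThreeLines

section Analytic

variable {E F : Type*} [NormedAddCommGroup E] [NormedSpace ℂ E]
  [NormedAddCommGroup F] [NormedSpace ℂ F]

theorem tendsto_clm_apply_of_norm_le {α : Type*} {l : Filter α} {P : α → E →L[ℂ] F}
    {w : α → E} {b : ℝ} {w₀ : E} {y₀ : F} (hb : ∀ᶠ a in l, ‖P a‖ ≤ b)
    (hP : Tendsto (fun a => P a w₀) l (𝓝 y₀)) (hw : Tendsto w l (𝓝 w₀)) :
    Tendsto (fun a => P a (w a)) l (𝓝 y₀) := by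
  have h : Tendsto (fun a => P a (w a - w₀)) l (𝓝 0) := by
    have h1 : Tendsto (fun a => b * ‖w a - w₀‖) l (𝓝 0) := by
      have := ((tendsto_iff_norm_sub_tendsto_zero.1 hw).const_mul b)
      simpa using this
    refine squeeze_zero_norm' ?_ h1
    filter_upwards [hb] with a ha
    exact (P a).le_of_opNorm_le ha _
  have h2 := h.add hP
  simpa using h2

theorem hasDerivAt_clm_apply_of_norm_le {P : ℂ → E →L[ℂ] F} {w : ℂ → E} {b : ℝ} {z : ℂ}
    {w' : E} {p' : F} (hb : ∀ᶠ ζ in 𝓝 z, ‖P ζ‖ ≤ b)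
    (hPc : ∀ x, ContinuousAt (fun ζ => P ζ x) z)
    (hP : HasDerivAt (fun ζ => P ζ (w z)) p' z) (hw : HasDerivAt w w' z) :
    HasDerivAt (fun ζ => P ζ (w ζ)) (P z w' + p') z := by
  rw [hasDerivAt_iff_tendsto_slope] at *
  have h1 := tendsto_clm_apply_of_norm_le (hb.filter_mono nhdsWithin_le_nhds)
    ((hPc w').tendsto.mono_left nhdsWithin_le_nhds) hw
  refine (h1.add hP).congr fun ζ => ?_
  simp only [slope, vsub_eq_sub, map_smul, map_sub, ← smul_add]
  congr 1
  abel

/-- Hadamard's three lines theorem for functions of at most exponential growth, with Gaussian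
regularization `e^{kz(z-1)}`. -/
theorem norm_le_of_exp_growth {V : ℂ → E} (hd : DiffContOnCl ℂ V (verticalStrip 0 1))
    {M d : ℝ} (hM : ∀ z ∈ closedStrip, ‖V z‖ ≤ M * Real.exp (d * |z.im|))
    {A B c : ℝ} (hA : 0 ≤ A) (hB : 0 ≤ B)
    (h0 : ∀ z : ℂ, z.re = 0 → ‖V z‖ ≤ A * Real.exp (c * |z.im|))
    (h1 : ∀ z : ℂ, z.re = 1 → ‖V z‖ ≤ B * Real.exp (c * |z.im|))
    {k : ℝ} (hk : 0 < k) {z : ℂ} (hz : z ∈ closedStrip) :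
    ‖V z‖ ≤ Real.exp (k * z.im ^ 2 + k * (z.re * (1 - z.re)) + (4 * k)⁻¹ * c ^ 2) *
      (A ^ (1 - z.re) * B ^ z.re) := by
  have hre : ∀ z : ℂ, (k * (z * (z - 1)) : ℂ).re = -(k * (z.re * (1 - z.re))) - k * z.im ^ 2 := by
    intro z
    simp [Complex.mul_re, Complex.mul_im]
    ring
  have hquad : ∀ (e t : ℝ), e * |t| - k * t ^ 2 ≤ (4 * k)⁻¹ * e ^ 2 := by
    intro e t
    have : (4 * k)⁻¹ * e ^ 2 - (e * |t| - k * t ^ 2) = (4 * k)⁻¹ * (e - 2 * k * |t|) ^ 2 := by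
      rw [← sq_abs t]
      field_simp
      ring
    have h2 : 0 ≤ (4 * k)⁻¹ * (e - 2 * k * |t|) ^ 2 := by positivity
    linarith
  set f : ℂ → E := fun z => Complex.exp (k * (z * (z - 1))) • V z with hf
  have hnorm : ∀ z, ‖f z‖ =
      Real.exp (-(k * (z.re * (1 - z.re))) - k * z.im ^ 2) * ‖V z‖ := by
    intro z
    simp only [hf, norm_smul, Complex.norm_exp, hre]
  have hfd : DiffContOnCl ℂ f (verticalStrip 0 1) := by
    refine DiffContOnCl.smul (Differentiable.diffContOnCl ?_) hd
    fun_prop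
  have hM0 : 0 ≤ M := by
    have := (norm_nonneg _).trans (hM 0 (by simp [closedStrip]))
    simpa using this
  have hbdd : BddAbove ((norm ∘ f) '' verticalClosedStrip 0 1) := by
    refine ⟨M * Real.exp ((4 * k)⁻¹ * d ^ 2), ?_⟩
    rintro _ ⟨z, hz, rfl⟩
    have hz' : z ∈ closedStrip := hz
    have hz0 : 0 ≤ k * (z.re * (1 - z.re)) := by
      have := hz'.1
      have := sub_nonneg.2 hz'.2
      positivity
    simp only [Function.comp, hnorm]
    calc _ ≤ Real.exp (-(k * (z.re * (1 - z.re))) - k * z.im ^ 2) *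
          (M * Real.exp (d * |z.im|)) := by gcongr; exact hM z hz'
      _ = M * Real.exp (-(k * (z.re * (1 - z.re))) - k * z.im ^ 2 + d * |z.im|) := by
          rw [Real.exp_add]; ring
      _ ≤ _ := by
          gcongr
          linarith [hquad d z.im]
  have hedge : ∀ (K : ℝ) (z : ℂ), 0 ≤ K → z.re * (1 - z.re) = 0 →
      ‖V z‖ ≤ K * Real.exp (c * |z.im|) → ‖f z‖ ≤ K * Real.exp ((4 * k)⁻¹ * c ^ 2) := by
    intro K z hK hz h
    rw [hnorm, hz]
    calc _ ≤ Real.exp (-(k * 0) - k * z.im ^ 2) * (K * Real.exp (c * |z.im|)) := by gcongr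
      _ = K * Real.exp (-(k * 0) - k * z.im ^ 2 + c * |z.im|) := by
          rw [Real.exp_add]; ring
      _ ≤ _ := by
          gcongr
          linarith [hquad c z.im]
  have key := norm_le_interp_of_mem_verticalClosedStrip' zero_lt_one
    (show z ∈ verticalClosedStrip 0 1 from hz) hfd hbdd
    (a := A * Real.exp ((4 * k)⁻¹ * c ^ 2)) (b := B * Real.exp ((4 * k)⁻¹ * c ^ 2))
    (fun z (hz : z.re = 0) => hedge A z hA (by simp [hz]) (h0 z hz))
    (fun z (hz : z.re = 1) => hedge B z hB (by simp [hz]) (h1 z hz))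
  simp only [sub_zero, div_one, hnorm] at key
  set K := Real.exp ((4 * k)⁻¹ * c ^ 2) with hK
  have hK0 : 0 < K := Real.exp_pos _
  have hcomb : (A * K) ^ (1 - z.re) * (B * K) ^ z.re = K * (A ^ (1 - z.re) * B ^ z.re) := by
    rw [Real.mul_rpow hA hK0.le, Real.mul_rpow hB hK0.le]
    have : K ^ (1 - z.re) * K ^ z.re = K := by
      rw [← Real.rpow_add hK0]; simp
    calc _ = (K ^ (1 - z.re) * K ^ z.re) * (A ^ (1 - z.re) * B ^ z.re) := by ring
      _ = _ := by rw [this]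
  rw [hcomb] at key
  have hsplit : Real.exp (k * z.im ^ 2 + k * (z.re * (1 - z.re)) + (4 * k)⁻¹ * c ^ 2) =
      Real.exp (k * z.im ^ 2 + k * (z.re * (1 - z.re))) * K := Real.exp_add _ _
  rw [hsplit, mul_assoc]
  calc ‖V z‖ = Real.exp (k * z.im ^ 2 + k * (z.re * (1 - z.re))) *
        (Real.exp (-(k * (z.re * (1 - z.re))) - k * z.im ^ 2) * ‖V z‖) := by
        rw [← mul_assoc, ← Real.exp_add]
        ring_nf
        simp
    _ ≤ _ := by gcongr

theorem le_of_forall_pos_le_exp_mul {N A p : ℝ}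
    (h : ∀ k : ℝ, 0 < k → N ≤ Real.exp (k * p) * A) : N ≤ A := by
  have ht : Tendsto (fun k : ℝ => Real.exp (k * p) * A) (𝓝[>] 0) (𝓝 A) := by
    have : Continuous fun k : ℝ => Real.exp (k * p) * A := by fun_prop
    simpa using (this.tendsto 0).mono_left nhdsWithin_le_nhds
  exact ge_of_tendsto ht (by filter_upwards [self_mem_nhdsWithin] with k hk using h k hk)

theorem le_exp_sqrt_mul_of_forall {N A q c : ℝ} (hq : 0 ≤ q) (hc : 0 < c)
    (h : ∀ k : ℝ, 0 < k → N ≤ Real.exp (k * q + (4 * k)⁻¹ * c ^ 2) * A) :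
    N ≤ Real.exp (c * Real.sqrt q) * A := by
  rcases hq.eq_or_lt with rfl | hq
  · rw [Real.sqrt_zero, mul_zero, Real.exp_zero, one_mul]
    refine le_of_forall_pos_le_exp_mul (p := 4⁻¹ * c ^ 2) fun k hk => ?_
    refine (h k⁻¹ (by positivity)).trans_eq ?_
    congr 2
    field_simp
    ring
  · have hs := Real.sqrt_pos.2 hq
    refine (h (c / (2 * Real.sqrt q)) (by positivity)).trans_eq ?_
    congr 2
    have : q = Real.sqrt q ^ 2 := (Real.sq_sqrt hq.le).symm
    set s := Real.sqrt q
    rw [this]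
    field_simp
    ring

end Analytic

section Powers

variable {E F : Type*} [NormedAddCommGroup E] [InnerProductSpace ℂ E]
  [NormedAddCommGroup F] [InnerProductSpace ℂ F]
  {T : E →ₗ.[ℂ] E} {Tinv : E →L[ℂ] E} {P : ℂ → E →L[ℂ] E}

theorem IsSpectralInvPowers.norm_le_exp (hP : IsSpectralInvPowers T Tinv P) {z : ℂ}
    (hz : z ∈ closedStrip) : ‖P z‖ ≤ max 1 ‖Tinv‖ * Real.exp (Real.pi * |z.im|) := by
  refine (hP.norm_le z hz).trans_eq ?_
  rw [max_eq_right (a := 1) (b := Real.exp _)]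
  exact Real.one_le_exp (mul_nonneg Real.pi_pos.le (abs_nonneg _))

theorem IsSpectralInvPowers.norm_imaginary_le_one (hP : IsSpectralInvPowers T Tinv P)
    (hT : IsNonnegPMap T) (s : ℝ) : ‖P (Complex.I * s)‖ ≤ 1 :=
  ContinuousLinearMap.opNorm_le_bound _ zero_le_one fun x => by
    rw [hP.isometry_imaginary_of_nonneg hT, one_mul]

theorem IsSpectralInvPowers.eventually_norm_le (hP : IsSpectralInvPowers T Tinv P) (z : ℂ) :
    ∀ᶠ ζ in 𝓝 z, ζ ∈ closedStrip →
      ‖P ζ‖ ≤ max 1 ‖Tinv‖ * Real.exp (Real.pi * (|z.im| + 1)) := by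
  have hc : Tendsto (fun ζ : ℂ => |ζ.im|) (𝓝 z) (𝓝 |z.im|) :=
    (Complex.continuous_im.abs).tendsto z
  filter_upwards [hc.eventually_lt_const (lt_add_one _)] with ζ hζ hmem
  refine (hP.norm_le_exp hmem).trans ?_
  have := Real.pi_pos
  gcongr

theorem one_sub_mem_closedStrip {z : ℂ} (hz : z ∈ closedStrip) : 1 - z ∈ closedStrip := by
  have h1 := hz.1
  have h2 := hz.2
  simp only [closedStrip, Set.mem_ofPred_eq, Set.mem_Icc, Complex.sub_re, Complex.one_re]
  constructor <;> linarith

variable {T₂ : F →ₗ.[ℂ] F} {Tinv₂ : F →L[ℂ] F} {P₂ : ℂ → F →L[ℂ] F}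

theorem IsSpectralInvPowers.continuousOn_interp (hP : IsSpectralInvPowers T Tinv P)
    (hP₂ : IsSpectralInvPowers T₂ Tinv₂ P₂) (C : E →L[ℂ] F) (u : E) :
    ContinuousOn (fun z => P₂ z (C (P (1 - z) u))) closedStrip := by
  intro z hz
  refine tendsto_clm_apply_of_norm_le (w₀ := C (P (1 - z) u))
    (b := max 1 ‖Tinv₂‖ * Real.exp (Real.pi * (|z.im| + 1)))
    ?_ ?_ ?_
  · filter_upwards [self_mem_nhdsWithin, nhdsWithin_le_nhds (hP₂.eventually_norm_le z)]
      with ζ h1 h2 using h2 h1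
  · exact (hP₂.strong_continuous _ z hz.1).mono fun ζ hζ => hζ.1
  · have h : ContinuousWithinAt (fun z => P (1 - z) u) closedStrip z := by
      have h1 := hP.strong_continuous u (1 - z) (one_sub_mem_closedStrip hz).1
      refine ContinuousWithinAt.comp (f := fun z : ℂ => 1 - z) h1 (by fun_prop) ?_
      intro ζ hζ
      exact (one_sub_mem_closedStrip hζ).1
    exact (C.continuous.continuousAt.comp_continuousWithinAt h).tendsto

theorem IsSpectralInvPowers.diffContOnCl_interp (hP : IsSpectralInvPowers T Tinv P)
    (hP₂ : IsSpectralInvPowers T₂ Tinv₂ P₂) (C : E →L[ℂ] F) (u : E) :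
    DiffContOnCl ℂ (fun z => P₂ z (C (P (1 - z) u))) (verticalStrip 0 1) := by
  have hopen : IsOpen {z : ℂ | 0 < z.re} := isOpen_lt continuous_const Complex.continuous_re
  constructor
  · intro z hz
    have hz' : z ∈ closedStrip := ⟨hz.1.le, hz.2.le⟩
    refine DifferentiableAt.differentiableWithinAt ?_
    have hstrip : verticalStrip 0 1 ∈ 𝓝 z :=
      (isOpen_Ioo.preimage Complex.continuous_re).mem_nhds hz
    have hd2 : ∀ y, DifferentiableAt ℂ (fun ζ => P₂ ζ y) z := fun y =>
      (hP₂.analytic y).differentiableAt (hopen.mem_nhds hz.1)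
    have hd1 : DifferentiableAt ℂ (fun ζ => C (P (1 - ζ) u)) z := by
      have h1 : DifferentiableAt ℂ (fun ζ => P ζ u) (1 - z) :=
        (hP.analytic u).differentiableAt (hopen.mem_nhds (by simpa using hz.2))
      have h2 : DifferentiableAt ℂ (fun ζ => P (1 - ζ) u) z :=
        DifferentiableAt.comp (f := fun ζ : ℂ => 1 - ζ) z h1 (by fun_prop)
      exact C.differentiableAt.comp z h2
    refine (hasDerivAt_clm_apply_of_norm_le
      (b := max 1 ‖Tinv₂‖ * Real.exp (Real.pi * (|z.im| + 1))) ?_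
      (fun y => (hd2 y).continuousAt) (hd2 _).hasDerivAt hd1.hasDerivAt).differentiableAt
    filter_upwards [hstrip, hP₂.eventually_norm_le z] with ζ h1 h2
    exact h2 ⟨h1.1.le, h1.2.le⟩
  · refine (hP.continuousOn_interp hP₂ C u).mono ?_
    refine closure_minimal (fun ζ hζ => ⟨hζ.1.le, hζ.2.le⟩) ?_
    exact isClosed_Icc.preimage Complex.continuous_re

/-- The adjoint of a bounded operator commuting with a self-adjoint operator preserves its
domain. -/
theorem adjoint_mem_domain_of_commutes [CompleteSpace E] (hT : IsSelfAdjoint T) (A : E →L[ℂ] E)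
    (hmaps : ∀ x ∈ T.domain, A x ∈ T.domain)
    (hcomm : ∀ x : T.domain, ∀ hx : A (x : E) ∈ T.domain, T ⟨A (x : E), hx⟩ = A (T x))
    {y : E} (hy : y ∈ T.domain) : ContinuousLinearMap.adjoint A y ∈ T.domain := by
  have hsymm : T.IsFormalAdjoint T := by
    have := LinearPMap.adjoint_isFormalAdjoint hT.dense_domain
    rwa [LinearPMap.isSelfAdjoint_def.1 hT] at this
  rw [← LinearPMap.isSelfAdjoint_def.1 hT]
  refine LinearPMap.mem_adjoint_domain_of_exists _ ⟨ContinuousLinearMap.adjoint A (T ⟨y, hy⟩), ?_⟩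
  intro x
  rw [ContinuousLinearMap.adjoint_inner_left, ContinuousLinearMap.adjoint_inner_left,
    ← hcomm x (hmaps _ x.2)]
  exact hsymm ⟨y, hy⟩ ⟨A x, hmaps _ x.2⟩

/-- `‖T₂⁻¹ S v‖ ≤ ‖S* T₂⁻¹‖ ‖v‖`. -/
theorem norm_inv_comp_le [CompleteSpace E] [CompleteSpace F]
    {S : E →ₗ.[ℂ] F} (hdense : Dense (S.domain : Set E))
    (hT₂ : IsSelfAdjoint T₂) (hTinv₂ : IsBoundedInverse T₂ Tinv₂) {D : F →L[ℂ] E}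
    (hD : IsComposition S.adjoint Tinv₂ D) (v : S.domain) :
    ‖Tinv₂ (S v)‖ ≤ ‖D‖ * ‖(v : E)‖ := by
  have hsymm : T₂.IsFormalAdjoint T₂ := by
    have := LinearPMap.adjoint_isFormalAdjoint hT₂.dense_domain
    rwa [LinearPMap.isSelfAdjoint_def.1 hT₂] at this
  have hinv : ∀ a b : F, ⟪Tinv₂ a, b⟫_ℂ = ⟪a, Tinv₂ b⟫_ℂ := by
    intro a b
    obtain ⟨ha, ha'⟩ := hTinv₂.2 a
    obtain ⟨hb, hb'⟩ := hTinv₂.2 b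
    have := hsymm ⟨Tinv₂ a, ha⟩ ⟨Tinv₂ b, hb⟩
    rw [ha', hb'] at this
    exact this.symm
  have hform : ∀ a : F, ⟪a, Tinv₂ (S v)⟫_ℂ = ⟪D a, (v : E)⟫_ℂ := by
    intro a
    obtain ⟨ha, ha'⟩ := hD a
    rw [← hinv, ← ha']
    exact (LinearPMap.adjoint_isFormalAdjoint hdense ⟨Tinv₂ a, ha⟩ v).symm
  have heq : Tinv₂ (S v) = ContinuousLinearMap.adjoint D (v : E) :=
    ext_inner_left ℂ fun a => by rw [hform, ContinuousLinearMap.adjoint_inner_right]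
  rw [heq]
  refine (ContinuousLinearMap.le_opNorm _ _).trans_eq ?_
  rw [LinearIsometryEquiv.norm_map]

theorem IsSpectralInvPowers.apply_add_one (hP : IsSpectralInvPowers T Tinv P)
    (hTinv : IsBoundedInverse T Tinv) {z : ℂ} (hz : 0 ≤ z.re) (x : T.domain) :
    P (z + 1) (T x) = P z (x : E) := by
  rw [hP.semigroup z 1 hz (by simp), hP.one, ContinuousLinearMap.comp_apply, hTinv.1]

theorem IsSpectralInvPowers.inv_apply (hP : IsSpectralInvPowers T Tinv P) {z : ℂ}
    (hz : 0 ≤ z.re) (x : E) : Tinv (P z x) = P (z + 1) x := by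
  rw [add_comm, hP.semigroup 1 z (by simp) hz, hP.one, ContinuousLinearMap.comp_apply]

/-- The interpolation estimate on the core `dom T`, given a bound on the imaginary powers. -/
theorem norm_interp_le [CompleteSpace E] [CompleteSpace F]
    {S : E →ₗ.[ℂ] F} (hTinv : IsBoundedInverse T Tinv)
    (hT₂ : IsSelfAdjoint T₂) (hTinv₂ : IsBoundedInverse T₂ Tinv₂)
    (hP : IsSpectralInvPowers T Tinv P) (hP₂ : IsSpectralInvPowers T₂ Tinv₂ P₂)
    (hdense : Dense (S.domain : Set E)) {C : E →L[ℂ] F} {D : F →L[ℂ] E}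
    (hC : IsComposition S Tinv C) (hD : IsComposition S.adjoint Tinv₂ D) {c : ℝ}
    (hc : ∀ t : ℝ, ‖P₂ (Complex.I * t)‖ * ‖P (Complex.I * (-t : ℝ))‖ ≤ Real.exp (c * |t|))
    {k : ℝ} (hk : 0 < k) {z : ℂ} (hz : z ∈ closedStrip) (x : T.domain) :
    ‖P₂ z (C (P (1 - z) (T x)))‖ ≤
      Real.exp (k * z.im ^ 2 + k * (z.re * (1 - z.re)) + (4 * k)⁻¹ * c ^ 2) *
        (‖C‖ ^ (1 - z.re) * ‖D‖ ^ z.re) * ‖(x : E)‖ := by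
  have hedge : ∀ t : ℝ, ∀ K : ℝ, 0 ≤ K →
      ‖P₂ (Complex.I * t)‖ * (K * ‖P (Complex.I * (-t : ℝ)) (x : E)‖) ≤
        K * ‖(x : E)‖ * Real.exp (c * |t|) := by
    intro t K hK
    calc _ ≤ ‖P₂ (Complex.I * t)‖ * (K * (‖P (Complex.I * (-t : ℝ))‖ * ‖(x : E)‖)) := by
          gcongr
          exact ContinuousLinearMap.le_opNorm _ _
      _ = K * ‖(x : E)‖ * (‖P₂ (Complex.I * t)‖ * ‖P (Complex.I * (-t : ℝ))‖) := by ring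
      _ ≤ _ := by
          gcongr
          exact hc t
  have key := norm_le_of_exp_growth (hP.diffContOnCl_interp hP₂ C (T x))
    (M := max 1 ‖Tinv₂‖ * ‖C‖ * max 1 ‖Tinv‖ * ‖T x‖) (d := 2 * Real.pi) ?_
    (A := ‖C‖ * ‖(x : E)‖) (B := ‖D‖ * ‖(x : E)‖) (c := c) (by positivity) (by positivity)
    ?_ ?_ hk hz
  · refine key.trans_eq ?_
    have hx0 : ‖(x : E)‖ ^ (1 - z.re) * ‖(x : E)‖ ^ z.re = ‖(x : E)‖ := by
      rw [← Real.rpow_add_of_nonneg (norm_nonneg _) (sub_nonneg.2 hz.2) hz.1]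
      simp
    rw [Real.mul_rpow (norm_nonneg _) (norm_nonneg _),
      Real.mul_rpow (norm_nonneg _) (norm_nonneg _), mul_mul_mul_comm, hx0, ← mul_assoc]
  · intro ζ hζ
    have h1 := hP.norm_le_exp (one_sub_mem_closedStrip hζ)
    have h2 := hP₂.norm_le_exp hζ
    have him : |(1 - ζ).im| = |ζ.im| := by simp
    rw [him] at h1
    calc _ ≤ ‖P₂ ζ‖ * (‖C‖ * (‖P (1 - ζ)‖ * ‖T x‖)) := by
          refine (ContinuousLinearMap.le_opNorm _ _).trans ?_
          gcongr
          refine (ContinuousLinearMap.le_opNorm _ _).trans ?_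
          gcongr
          exact ContinuousLinearMap.le_opNorm _ _
      _ ≤ (max 1 ‖Tinv₂‖ * Real.exp (Real.pi * |ζ.im|)) *
          (‖C‖ * ((max 1 ‖Tinv‖ * Real.exp (Real.pi * |ζ.im|)) * ‖T x‖)) := by gcongr
      _ = max 1 ‖Tinv₂‖ * ‖C‖ * max 1 ‖Tinv‖ * ‖T x‖ *
          (Real.exp (Real.pi * |ζ.im|) * Real.exp (Real.pi * |ζ.im|)) := by ring
      _ = _ := by
          rw [← Real.exp_add]
          ring_nf
  · intro ζ hζ
    have h1 : ζ = Complex.I * (ζ.im : ℝ) := by apply Complex.ext <;> simp [hζ]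
    have h2 : 1 - ζ = Complex.I * (-ζ.im : ℝ) + 1 := by
      apply Complex.ext <;> simp [hζ]
    simp only [h2, hP.apply_add_one hTinv (show 0 ≤ (Complex.I * (-ζ.im : ℝ) : ℂ).re by simp)]
    refine le_trans ?_ (hedge ζ.im ‖C‖ (norm_nonneg _))
    rw [← h1]
    refine (ContinuousLinearMap.le_opNorm _ _).trans ?_
    gcongr
    exact ContinuousLinearMap.le_opNorm _ _
  · intro ζ hζ
    have h1 : ζ = Complex.I * (ζ.im : ℝ) + 1 := by apply Complex.ext <;> simp [hζ]
    have h2 : 1 - ζ = Complex.I * (-ζ.im : ℝ) := by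
      apply Complex.ext <;> simp [hζ]
    have h3 : P₂ ζ = P₂ (Complex.I * (ζ.im : ℝ)) ∘L Tinv₂ := by
      rw [← hP₂.one, ← hP₂.semigroup _ _ (by simp) (by simp), ← h1]
    obtain ⟨hm, hm'⟩ := hC (P (1 - ζ) (T x))
    have h4 : Tinv (P (1 - ζ) (T x)) = P (Complex.I * (-ζ.im : ℝ)) (x : E) := by
      rw [h2, hP.inv_apply (by simp), hP.apply_add_one hTinv (by simp)]
    have h5 := norm_inv_comp_le hdense hT₂ hTinv₂ hD ⟨_, hm⟩
    rw [hm'] at h5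
    refine le_trans ?_ (hedge ζ.im ‖D‖ (norm_nonneg _))
    rw [h3, ContinuousLinearMap.comp_apply, ← h4]
    refine (ContinuousLinearMap.le_opNorm _ _).trans ?_
    gcongr

theorem IsSpectralInvPowers.norm_imaginary_mul_le (hP : IsSpectralInvPowers T Tinv P)
    (hP₂ : IsSpectralInvPowers T₂ Tinv₂ P₂) (t : ℝ) :
    ‖P₂ (Complex.I * t)‖ * ‖P (Complex.I * (-t : ℝ))‖ ≤ Real.exp (Real.pi * |t|) := by
  refine (mul_le_mul (hP₂.norm_imaginary t) (hP.norm_imaginary (-t)) (norm_nonneg _)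
    (by positivity)).trans ?_
  have hpi := Real.pi_pos
  rcases le_total 0 t with ht | ht
  · rw [abs_of_nonneg ht, max_eq_right (Real.one_le_exp (by positivity)), max_eq_left, mul_one]
    exact Real.exp_le_one_iff.2 (by nlinarith)
  · rw [abs_of_nonpos ht, max_eq_left, max_eq_right (Real.one_le_exp (by nlinarith)), one_mul]
    exact Real.exp_le_one_iff.2 (by nlinarith)

/-- The operator `T₂^{-z} S T₁^{-1+z}` on its maximal domain. -/
abbrev interpPMap (P : ℂ → E →L[ℂ] E) (P₂ : ℂ → F →L[ℂ] F) (S : E →ₗ.[ℂ] F) (z : ℂ) :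
    E →ₗ.[ℂ] F :=
  LinearMap.compPMap ((P₂ z) : F →ₗ[ℂ] F) (mcomp S (((P (1 - z)) : E →ₗ[ℂ] E).toPMap ⊤))

theorem interpPMap_apply (S : E →ₗ.[ℂ] F) (z : ℂ) (x : (interpPMap P P₂ S z).domain) :
    ∃ h : P (1 - z) (x : E) ∈ S.domain, interpPMap P P₂ S z x = P₂ z (S ⟨P (1 - z) x, h⟩) :=
  ⟨x.2.choose_spec, rfl⟩

theorem le_interpPMap_domain {S : E →ₗ.[ℂ] F} (hP : IsSpectralInvPowers T Tinv P)
    (hdom : T.domain ≤ S.domain) {z : ℂ} (hz : z ∈ closedStrip) :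
    T.domain ≤ (interpPMap P P₂ S z).domain := fun x hx =>
  ⟨Submodule.mem_top, hdom (hP.mapsTo_domain _ (one_sub_mem_closedStrip hz).1 x hx)⟩

theorem interpPMap_apply_of_mem {S : E →ₗ.[ℂ] F} (hP : IsSpectralInvPowers T Tinv P)
    (hTinv : IsBoundedInverse T Tinv) {C : E →L[ℂ] F} (hC : IsComposition S Tinv C)
    {z : ℂ} (hz : z ∈ closedStrip) (x : T.domain)
    (hx : (x : E) ∈ (interpPMap P P₂ S z).domain) :
    interpPMap P P₂ S z ⟨x, hx⟩ = P₂ z (C (P (1 - z) (T x))) := by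
  have hz' := (one_sub_mem_closedStrip hz).1
  obtain ⟨h, h'⟩ := interpPMap_apply S z ⟨x, hx⟩
  obtain ⟨hm, hm'⟩ := hC (P (1 - z) (T x))
  have heq : P (1 - z) (x : E) = Tinv (P (1 - z) (T x)) := by
    rw [hP.inv_apply hz', hP.apply_add_one hTinv hz']
  rw [h', ← hm']
  congr 2
  exact Subtype.ext heq

/-- A bounded operator agreeing with `T₂^{-z} S T₁^{-1+z}` on `dom T₁` extends it. -/
theorem extendsTo_interpPMap [CompleteSpace E] [CompleteSpace F]
    {S : E →ₗ.[ℂ] F} (hT : IsSelfAdjoint T) (hT₂ : IsSelfAdjoint T₂)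
    (hP : IsSpectralInvPowers T Tinv P) (hP₂ : IsSpectralInvPowers T₂ Tinv₂ P₂)
    (hdom : T.domain ≤ S.domain) (hdom₂ : T₂.domain ≤ S.adjoint.domain)
    {z : ℂ} (hz : z ∈ closedStrip) {B : E →L[ℂ] F}
    (hB : ∀ (x : E) (hx : x ∈ T.domain),
      interpPMap P P₂ S z ⟨x, le_interpPMap_domain hP hdom hz hx⟩ = B x) :
    ExtendsTo (interpPMap P P₂ S z) B := by
  have hdense : Dense (S.domain : Set E) := hT.dense_domain.mono hdom
  intro x
  refine hT₂.dense_domain.eq_of_inner_right ℂ fun y hy => ?_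
  have hy' : ContinuousLinearMap.adjoint (P₂ z) y ∈ S.adjoint.domain :=
    hdom₂ (adjoint_mem_domain_of_commutes hT₂ (P₂ z) (hP₂.mapsTo_domain z hz.1)
      (hP₂.commutes z hz.1) hy)
  set g := ContinuousLinearMap.adjoint (P (1 - z)) (S.adjoint ⟨_, hy'⟩) with hg
  have hgx : ∀ x : (interpPMap P P₂ S z).domain,
      ⟪y, interpPMap P P₂ S z x⟫_ℂ = ⟪g, (x : E)⟫_ℂ := by
    intro x
    obtain ⟨h, h'⟩ := interpPMap_apply S z x
    rw [h', hg, ContinuousLinearMap.adjoint_inner_left, ← ContinuousLinearMap.adjoint_inner_left]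
    exact (LinearPMap.adjoint_isFormalAdjoint hdense ⟨_, hy'⟩ ⟨_, h⟩).symm
  have hgB : (fun x : E => ⟪g, x⟫_ℂ) = fun x => ⟪y, B x⟫_ℂ :=
    Continuous.ext_on hT.dense_domain (by fun_prop) (by fun_prop) fun x hx => by
      rw [← hB x hx, hgx]
  rw [hgx]
  exact congrFun hgB x

theorem ExtendsTo.isClosable {Y : E →ₗ.[ℂ] F} {B : E →L[ℂ] F} (h : ExtendsTo Y B) :
    Y.IsClosable := by
  have hcl : ((B : E →ₗ[ℂ] F).toPMap ⊤).IsClosed := by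
    have : (((B : E →ₗ[ℂ] F).toPMap ⊤).graph : Set (E × F)) = {p | B p.1 = p.2} := by
      ext p
      simp [LinearPMap.mem_graph_iff]
    rw [LinearPMap.IsClosed, this]
    exact isClosed_eq (by fun_prop) (by fun_prop)
  refine hcl.isClosable.leIsClosable ⟨le_top, ?_⟩
  rintro x ⟨y, hy⟩ rfl
  exact h x

theorem exists_extendsTo_interpPMap [CompleteSpace E] [CompleteSpace F]
    {S : E →ₗ.[ℂ] F} (hT : IsSelfAdjoint T)
    (hT₂ : IsSelfAdjoint T₂) (hTinv : IsBoundedInverse T Tinv)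
    (hP : IsSpectralInvPowers T Tinv P) (hP₂ : IsSpectralInvPowers T₂ Tinv₂ P₂)
    (hdom : T.domain ≤ S.domain) (hdom₂ : T₂.domain ≤ S.adjoint.domain)
    {C : E →L[ℂ] F} (hC : IsComposition S Tinv C) {z : ℂ} (hz : z ∈ closedStrip) {K : ℝ}
    (hK : ∀ x : T.domain, ‖P₂ z (C (P (1 - z) (T x)))‖ ≤ K * ‖(x : E)‖) :
    ∃ B : E →L[ℂ] F, ExtendsTo (interpPMap P P₂ S z) B := by
  let f : T.domain →ₗ[ℂ] F := ((P₂ z ∘L C ∘L P (1 - z) : E →L[ℂ] F) : E →ₗ[ℂ] F) ∘ₗ T.toFun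
  have hrange : DenseRange T.domain.subtype := hT.dense_domain.denseRange_val
  refine ⟨f.extendOfNorm T.domain.subtype,
    extendsTo_interpPMap hT hT₂ hP hP₂ hdom hdom₂ hz fun x hx => ?_⟩
  rw [interpPMap_apply_of_mem hP hTinv hC hz ⟨x, hx⟩]
  exact (LinearMap.extendOfNorm_eq (f := f) hrange ⟨K, hK⟩ ⟨x, hx⟩).symm

/-- A bounded extension of `T₂^{-z} S T₁^{-1+z}` obeys every bound valid on `dom T₁`. -/
theorem ExtendsTo.norm_le_of_interp [CompleteSpace E] {S : E →ₗ.[ℂ] F} (hT : IsSelfAdjoint T)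
    (hTinv : IsBoundedInverse T Tinv) (hP : IsSpectralInvPowers T Tinv P)
    (hdom : T.domain ≤ S.domain) {C : E →L[ℂ] F} (hC : IsComposition S Tinv C) {z : ℂ}
    (hz : z ∈ closedStrip) {K : ℝ} (hK0 : 0 ≤ K)
    (hK : ∀ x : T.domain, ‖P₂ z (C (P (1 - z) (T x)))‖ ≤ K * ‖(x : E)‖) {B : E →L[ℂ] F}
    (hB : ExtendsTo (interpPMap P P₂ S z) B) : ‖B‖ ≤ K := by
  refine B.opNorm_le_bound hK0 fun x => ?_
  have hclosed : IsClosed {x : E | ‖B x‖ ≤ K * ‖x‖} :=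
    isClosed_le (by fun_prop) (by fun_prop)
  have hsub : (T.domain : Set E) ⊆ {x : E | ‖B x‖ ≤ K * ‖x‖} := by
    intro x hx
    have h := hK ⟨x, hx⟩
    rwa [← interpPMap_apply_of_mem hP hTinv hC hz ⟨x, hx⟩ (le_interpPMap_domain hP hdom hz hx),
      hB] at h
  exact hclosed.closure_subset_iff.2 hsub (hT.dense_domain x)

end Powers

end OpInterp

open OpInterp in
/-- Corollary 2.9.  Let `T₁, T₂` be self-adjoint in `H₁, H₂` with
`Tⱼ⁻¹ ∈ B(Hⱼ)` and `S` closed from `H₁` to `H₂` with `dom S ⊇ dom T₁`,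
`dom S* ⊇ dom T₂`.  Then for `z ∈ Σ̄`, `T₂^{-z}ST₁^{-1+z}` (defined on `dom T₁`) is
closable with closure in `B(H₁,H₂)`, and for every `k > 0`
`‖cl(T₂^{-z}ST₁^{-1+z})‖ ≤ C(z,k) ‖ST₁⁻¹‖^{1-Re z} ‖S*T₂⁻¹‖^{Re z}` with
`C(z,k) = e^{k|Im z|²+k Re z(1-Re z)+k⁻¹π²}` in general,
`C(z,k) = e^{k|Im z|²+k Re z(1-Re z)+(4k)⁻¹π²}` if `T₁ ≥ 0` or `T₂ ≥ 0`, and `C(z,k)=1` if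
both; and accordingly for `x ∈ [0,1]` with prefactors `e^{2π√(x(1-x))}`, `e^{π√(x(1-x))}`,
`1`.  Here `Pⱼ w = Tⱼ^{-w}` are the spectral power families. -/
theorem statement10
    {H₁ H₂ : Type*} [NormedAddCommGroup H₁] [InnerProductSpace ℂ H₁] [CompleteSpace H₁]
    [TopologicalSpace.SeparableSpace H₁]
    [NormedAddCommGroup H₂] [InnerProductSpace ℂ H₂] [CompleteSpace H₂]
    [TopologicalSpace.SeparableSpace H₂]
    (T₁ : H₁ →ₗ.[ℂ] H₁) (T₂ : H₂ →ₗ.[ℂ] H₂) (S : H₁ →ₗ.[ℂ] H₂)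
    (Tinv₁ : H₁ →L[ℂ] H₁) (Tinv₂ : H₂ →L[ℂ] H₂)
    (P₁ : ℂ → H₁ →L[ℂ] H₁) (P₂ : ℂ → H₂ →L[ℂ] H₂)
    (STinv₁ : H₁ →L[ℂ] H₂) (SstarTinv₂ : H₂ →L[ℂ] H₁)
    (hT₁ : IsSelfAdjoint T₁) (hT₂ : IsSelfAdjoint T₂)
    (hTinv₁ : IsBoundedInverse T₁ Tinv₁) (hTinv₂ : IsBoundedInverse T₂ Tinv₂)
    (hP₁ : IsSpectralInvPowers T₁ Tinv₁ P₁) (hP₂ : IsSpectralInvPowers T₂ Tinv₂ P₂)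
    (hS : S.IsClosed) (hdomS : T₁.domain ≤ S.domain) (hdomS' : T₂.domain ≤ S.adjoint.domain)
    (hSTinv₁ : IsComposition S Tinv₁ STinv₁)
    (hSstarTinv₂ : IsComposition S.adjoint Tinv₂ SstarTinv₂) :
    (∀ z ∈ closedStrip,
      T₁.domain ≤ (LinearMap.compPMap ((P₂ z) : H₂ →ₗ[ℂ] H₂)
          (mcomp S (((P₁ (1 - z)) : H₁ →ₗ[ℂ] H₁).toPMap ⊤))).domain ∧
      (LinearMap.compPMap ((P₂ z) : H₂ →ₗ[ℂ] H₂)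
          (mcomp S (((P₁ (1 - z)) : H₁ →ₗ[ℂ] H₁).toPMap ⊤))).IsClosable ∧
      (∃ B : H₁ →L[ℂ] H₂, ExtendsTo (LinearMap.compPMap ((P₂ z) : H₂ →ₗ[ℂ] H₂)
          (mcomp S (((P₁ (1 - z)) : H₁ →ₗ[ℂ] H₁).toPMap ⊤))) B) ∧
      ∀ k : ℝ, 0 < k →
        ∀ B : H₁ →L[ℂ] H₂,
          ExtendsTo (LinearMap.compPMap ((P₂ z) : H₂ →ₗ[ℂ] H₂)
            (mcomp S (((P₁ (1 - z)) : H₁ →ₗ[ℂ] H₁).toPMap ⊤))) B →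
          ‖B‖ ≤ Real.exp (k * z.im ^ 2 + k * (z.re * (1 - z.re)) + k⁻¹ * Real.pi ^ 2) *
              (‖STinv₁‖ ^ (1 - z.re) * ‖SstarTinv₂‖ ^ z.re) ∧
          ((IsNonnegPMap T₁ ∨ IsNonnegPMap T₂) →
            ‖B‖ ≤ Real.exp (k * z.im ^ 2 + k * (z.re * (1 - z.re)) +
                (4 * k)⁻¹ * Real.pi ^ 2) *
              (‖STinv₁‖ ^ (1 - z.re) * ‖SstarTinv₂‖ ^ z.re)) ∧
          (IsNonnegPMap T₁ ∧ IsNonnegPMap T₂ →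
            ‖B‖ ≤ ‖STinv₁‖ ^ (1 - z.re) * ‖SstarTinv₂‖ ^ z.re)) ∧
    ∀ x ∈ Set.Icc (0 : ℝ) 1,
      ∀ B : H₁ →L[ℂ] H₂,
        ExtendsTo (LinearMap.compPMap ((P₂ (x : ℂ)) : H₂ →ₗ[ℂ] H₂)
          (mcomp S (((P₁ (1 - (x : ℂ))) : H₁ →ₗ[ℂ] H₁).toPMap ⊤))) B →
        ‖B‖ ≤ Real.exp (2 * Real.pi * Real.sqrt (x * (1 - x))) *
            (‖STinv₁‖ ^ (1 - x) * ‖SstarTinv₂‖ ^ x) ∧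
        ((IsNonnegPMap T₁ ∨ IsNonnegPMap T₂) →
          ‖B‖ ≤ Real.exp (Real.pi * Real.sqrt (x * (1 - x))) *
            (‖STinv₁‖ ^ (1 - x) * ‖SstarTinv₂‖ ^ x)) ∧
        (IsNonnegPMap T₁ ∧ IsNonnegPMap T₂ →
          ‖B‖ ≤ ‖STinv₁‖ ^ (1 - x) * ‖SstarTinv₂‖ ^ x) := by
  have hdense : Dense (S.domain : Set H₁) := hT₁.dense_domain.mono hdomS
  have hbound : ∀ c : ℝ,
      (∀ t : ℝ, ‖P₂ (Complex.I * t)‖ * ‖P₁ (Complex.I * (-t : ℝ))‖ ≤ Real.exp (c * |t|)) →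
      ∀ z ∈ closedStrip, ∀ k : ℝ, 0 < k → ∀ B : H₁ →L[ℂ] H₂,
        ExtendsTo (interpPMap P₁ P₂ S z) B →
        ‖B‖ ≤ Real.exp (k * z.im ^ 2 + k * (z.re * (1 - z.re)) + (4 * k)⁻¹ * c ^ 2) *
          (‖STinv₁‖ ^ (1 - z.re) * ‖SstarTinv₂‖ ^ z.re) :=
    fun c hc z hz k hk B hB =>
      hB.norm_le_of_interp hT₁ hTinv₁ hP₁ hdomS hSTinv₁ hz (by positivity)
        (norm_interp_le hTinv₁ hT₂ hTinv₂ hP₁ hP₂ hdense hSTinv₁ hSstarTinv₂ hc hk hz)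
  have hpi := hbound Real.pi (hP₁.norm_imaginary_mul_le hP₂)
  have hnonneg : IsNonnegPMap T₁ ∧ IsNonnegPMap T₂ → ∀ z ∈ closedStrip, ∀ B : H₁ →L[ℂ] H₂,
      ExtendsTo (interpPMap P₁ P₂ S z) B →
      ‖B‖ ≤ ‖STinv₁‖ ^ (1 - z.re) * ‖SstarTinv₂‖ ^ z.re := by
    rintro ⟨h1, h2⟩ z hz B hB
    refine le_of_forall_pos_le_exp_mul (p := z.im ^ 2 + z.re * (1 - z.re)) fun k hk => ?_
    refine (hbound 0 (fun t => ?_) z hz k hk B hB).trans_eq ?_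
    · rw [zero_mul, Real.exp_zero]
      exact mul_le_one₀ (hP₂.norm_imaginary_le_one h2 t) (norm_nonneg _)
        (hP₁.norm_imaginary_le_one h1 (-t))
    · congr 2
      ring
  refine ⟨fun z hz => ?_, fun x hx B hB => ?_⟩
  · obtain ⟨B₀, hB₀⟩ := exists_extendsTo_interpPMap hT₁ hT₂ hTinv₁ hP₁ hP₂ hdomS hdomS' hSTinv₁ hz
      (norm_interp_le hTinv₁ hT₂ hTinv₂ hP₁ hP₂ hdense hSTinv₁ hSstarTinv₂
        (hP₁.norm_imaginary_mul_le hP₂) one_pos hz)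
    refine ⟨le_interpPMap_domain hP₁ hdomS hz, hB₀.isClosable, ⟨B₀, hB₀⟩, fun k hk B hB =>
      ⟨(hpi z hz k hk B hB).trans ?_, fun _ => hpi z hz k hk B hB,
        fun h => hnonneg h z hz B hB⟩⟩
    have : (4 * k)⁻¹ ≤ k⁻¹ := inv_anti₀ hk (by linarith)
    gcongr
  · have hz : (x : ℂ) ∈ closedStrip := by simpa [closedStrip] using hx
    have hq : 0 ≤ x * (1 - x) := mul_nonneg hx.1 (sub_nonneg.2 hx.2)
    have hmain : ‖B‖ ≤ Real.exp (Real.pi * Real.sqrt (x * (1 - x))) *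
        (‖STinv₁‖ ^ (1 - x) * ‖SstarTinv₂‖ ^ x) :=
      le_exp_sqrt_mul_of_forall hq Real.pi_pos fun k hk => by
        simpa using hpi x hz k hk B hB
    refine ⟨hmain.trans ?_, fun _ => hmain, fun h => by simpa using hnonneg h x hz B hB⟩
    have hp := Real.pi_pos
    have : Real.pi ≤ 2 * Real.pi := by linarith
    gcongr
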